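/- arXiv:2502.03847 — 4 statements merged into one kernel-verified Lean document; each statement's English description precedes it below -/
import Mathlib

section
/- Let q ≥ 1 be an integer and let δ(ζ) = Σ_{j=0}^{q} δ_j ζ^j and μ(ζ) = Σ_{j=0}^{q} μ_j ζ^j be real polynomials of degree at most q, at least one of them of degree exactly q, having no common complex root. Assume that for every ζ ∈ ℂ with |ζ| < 1 one has μ(ζ) ≠ 0 and Re( δ(ζ)/μ(ζ) ) > 0. Then there exists a symmetric positive definite matrix G = (g_{ij}) ∈ ℝ^{q×q} such that for every real vector space V equipped with a symmetric positive semidefinite bilinear form b : V × V → ℝ and all w_0, w_1, …, w_q ∈ V, one has b( Σ_{i=0}^{q} δ_i w_{q−i} , Σ_{j=0}^{q} μ_j w_{q−j} ) ≥ Σ_{i,j=1}^{q} g_{ij} b(w_i, w_j) − Σ_{i,j=1}^{q} g_{ij} b(w_{i−1}, w_{j−1}). -/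
open Polynomial

lemma gs_inf_form {M E : Type*} [AddCommGroup M] [Module ℝ M] [AddCommGroup E] [Module ℝ E]
    (c : PreInnerProductSpace.Core ℝ M) (π : M →ₗ[ℝ] E) (hπ : Function.Surjective π) :
    ∃ g : E →ₗ[ℝ] E →ₗ[ℝ] ℝ, (∀ x y, g x y = g y x) ∧ (∀ x, 0 ≤ g x x) ∧
      (∀ p, g (π p) (π p) ≤ c.inner p p) ∧
      (∀ x ε, 0 < ε → ∃ p, π p = x ∧ c.inner p p ≤ g x x + ε) := by
  let _ : SeminormedAddCommGroup M := @InnerProductSpace.Core.toSeminormedAddCommGroup ℝ M _ _ _ c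
  let _ : InnerProductSpace ℝ M := InnerProductSpace.ofCore c
  have hin : ∀ p : M, c.inner p p = ‖p‖ ^ 2 := fun p => by
    rw [← real_inner_self_eq_norm_sq]
  let H := UniformSpace.Completion M
  let ι : M →ₗᵢ[ℝ] H := UniformSpace.Completion.toComplₗᵢ
  obtain ⟨s, hs⟩ := LinearMap.exists_rightInverse_of_surjective π (LinearMap.range_eq_top.2 hπ)
  have hs' : ∀ x, π (s x) = x := fun x => LinearMap.congr_fun hs x
  let K : Submodule ℝ H := ((LinearMap.ker π).map ι.toLinearMap).topologicalClosure
  have hKc : IsClosed (K : Set H) := Submodule.isClosed_topologicalClosure _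
  have : CompleteSpace K := hKc.completeSpace_coe
  let L : E →ₗ[ℝ] H := (Kᗮ.starProjection : H →ₗ[ℝ] H) ∘ₗ ι.toLinearMap ∘ₗ s
  have hL : ∀ x, L x = ι (s x) - K.starProjection (ι (s x)) := fun x => by
    simp [L, Submodule.starProjection_orthogonal]
  have hmem : ∀ k ∈ LinearMap.ker π, ι k ∈ K := fun k hk =>
    Submodule.le_topologicalClosure _ (Submodule.mem_map_of_mem hk)
  have hgx : ∀ x, (innerₗ H).compl₁₂ L L x x = ‖L x‖ ^ 2 := fun x => by
    simp
  refine ⟨(innerₗ H).compl₁₂ L L, fun x y => by simp [real_inner_comm], fun x => ?_, fun p => ?_,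
    fun x ε hε => ?_⟩
  · rw [hgx]; positivity
  · rw [hgx, hin]
    have h1 : L (π p) = Kᗮ.starProjection (ι p) := by
      have : p = s (π p) + (p - s (π p)) := by abel
      have hk : p - s (π p) ∈ LinearMap.ker π := by simp [hs']
      have h0 : Kᗮ.starProjection (ι (p - s (π p))) = 0 := by
        rw [Submodule.starProjection_orthogonal]
        simp only [sub_apply, ContinuousLinearMap.id_apply]
        rw [Submodule.starProjection_eq_self_iff.2 (hmem _ hk), sub_self]
      conv_rhs => rw [this, map_add, map_add, h0, add_zero]
      rfl
    rw [h1]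
    have h2 : ‖Kᗮ.starProjection (ι p)‖ ≤ ‖ι p‖ := Submodule.norm_starProjection_apply_le _ _
    rw [ι.norm_map] at h2
    gcongr
  · rw [hgx]
    have hcl : K.starProjection (ι (s x)) ∈
        closure (((LinearMap.ker π).map ι.toLinearMap : Submodule ℝ H) : Set H) := by
      have := K.starProjection_apply_mem (ι (s x))
      rwa [← SetLike.mem_coe, Submodule.topologicalClosure_coe] at this
    have hcont : ContinuousAt (fun y : H => ‖ι (s x) - y‖ ^ 2) (K.starProjection (ι (s x))) := by
      fun_prop
    have hev : ∀ᶠ y in nhds (K.starProjection (ι (s x))),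
        ‖ι (s x) - y‖ ^ 2 < ‖L x‖ ^ 2 + ε := by
      apply hcont.eventually_lt_const
      rw [hL]; linarith
    obtain ⟨y, hy, hyK⟩ := mem_closure_iff_nhds.1 hcl _ hev
    obtain ⟨k, hk, rfl⟩ := hyK
    refine ⟨s x - k, ?_, ?_⟩
    · rw [map_sub, hs', LinearMap.mem_ker.1 hk, sub_zero]
    · rw [hin, ← ι.norm_map, map_sub]
      exact le_of_lt hy

lemma gs_gram {V : Type*} [AddCommGroup V] [Module ℝ V] (b : V →ₗ[ℝ] V →ₗ[ℝ] ℝ)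
    (hs : ∀ v w : V, b v w = b w v) (hp : ∀ v : V, 0 ≤ b v v) (w : ℕ → V) (q : ℕ) :
    ∃ (m : ℕ) (c : Fin m → ℕ → ℝ), ∀ i ≤ q, ∀ j ≤ q, b (w i) (w j) = ∑ k, c k i * c k j := by
  let A : Matrix (Fin (q+1)) (Fin (q+1)) ℝ := Matrix.of fun i j => b (w i) (w j)
  have hA : A.PosSemidef := by
    refine Matrix.PosSemidef.of_dotProduct_mulVec_nonneg ?_ ?_
    · ext i j; simp [A, hs]
    · intro x
      have := hp (∑ i, x i • w i)
      simp only [map_sum, LinearMap.sum_apply, map_smul, LinearMap.smul_apply, smul_eq_mul] at this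
      refine this.trans_eq ?_
      simp only [dotProduct, Matrix.mulVec, A, Matrix.of_apply, Pi.star_apply, star_trivial]
      refine Finset.sum_congr rfl fun i _ => ?_
      congr 1
      refine Finset.sum_congr rfl fun j _ => ?_
      rw [hs]; ring
  obtain ⟨m, v, hv⟩ := Matrix.posSemidef_iff_eq_sum_vecMulVec.mp hA
  refine ⟨m, fun k i => if h : i < q+1 then v k ⟨i, h⟩ else 0, fun i hi j hj => ?_⟩
  have := congrFun (congrFun hv ⟨i, by omega⟩) ⟨j, by omega⟩
  simp [A, Matrix.sum_apply, Matrix.vecMulVec_apply] at this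
  rw [this]
  refine Finset.sum_congr rfl fun k _ => ?_
  simp only
  rw [dif_pos (by omega), dif_pos (by omega)]

open Real ComplexConjugate in
lemma gs_avg_pow {g : ℂ → ℂ} (hg : DifferentiableOn ℂ g (Metric.ball 0 1)) {r : ℝ} (h0 : 0 < r)
    (h1 : r < 1) (k m : ℕ) :
    circleAverage (fun z => z ^ (k + m) * g z * conj z ^ m) 0 r
      = (r : ℂ) ^ (2 * m) * (0 ^ k * g 0) := by
  have hr : |r| = r := abs_of_pos h0
  have e : Set.EqOn (fun z : ℂ => z ^ (k + m) * g z * conj z ^ m)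
      (fun z => ((r : ℂ) ^ (2 * m)) • (z ^ k * g z)) (Metric.sphere 0 |r|) := by
    intro z hz
    have hz' : z * conj z = (r : ℂ) ^ 2 := by
      rw [Complex.mul_conj, Complex.normSq_eq_norm_sq]
      simp at hz
      rw [hz, hr]; push_cast; ring
    simp only [smul_eq_mul]
    rw [pow_mul, ← hz', mul_pow]; ring
  rw [circleAverage_congr_sphere e, circleAverage_fun_smul, DiffContOnCl.circleAverage]
  · simp
  · have hd : DifferentiableOn ℂ (fun z => z ^ k * g z) (Metric.ball 0 1) := by fun_prop
    refine (hd.mono ?_).diffContOnCl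
    rw [hr]
    exact Metric.closure_ball_subset_closedBall.trans (Metric.closedBall_subset_ball h1)

open Real ComplexConjugate in
lemma gs_orth {r : ℝ} (h0 : 0 < r) (h1 : r < 1) (k m : ℕ) :
    circleAverage (fun z => z ^ k * conj z ^ m) 0 r = if k = m then (r : ℂ) ^ (2 * m) else 0 := by
  rcases le_or_gt m k with h | h
  · obtain ⟨l, rfl⟩ := Nat.exists_eq_add_of_le' h
    have := gs_avg_pow (g := fun _ => 1) (differentiableOn_const _) h0 h1 l m
    simp only [mul_one] at this
    rw [this]
    rcases Nat.eq_zero_or_pos l with rfl | hl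
    · simp
    · simp [hl.ne']
  · obtain ⟨l, rfl⟩ := Nat.exists_eq_add_of_le' h.le
    have := gs_avg_pow (g := fun _ => 1) (differentiableOn_const _) h0 h1 l k
    simp only [mul_one] at this
    have hl : l ≠ 0 := by rintro rfl; simp at h
    have e : (fun z : ℂ => z ^ k * conj z ^ (l + k))
        = (Complex.conjCLE : ℂ →L[ℝ] ℂ) ∘ (fun z => z ^ (l + k) * conj z ^ k) := by
      ext z; simp [mul_comm]
    rw [e, ContinuousLinearMap.circleAverage_comp_comm, this]
    · simp [hl]
    · apply ContinuousOn.circleIntegrable'; fun_prop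

open Real ComplexConjugate in
lemma gs_caratheodory {F g : ℂ → ℂ} (hF : ∀ z : ℂ, ‖z‖ < 1 → 0 ≤ (F z).re)
    (hg : DifferentiableOn ℂ g (Metric.ball 0 1)) (N : ℕ) (u y : ℕ → ℝ)
    (h : ∀ z : ℂ, ‖z‖ < 1 → F z * (∑ m ∈ Finset.range N, (u m : ℂ) * z ^ m)
      = (∑ m ∈ Finset.range N, (y m : ℂ) * z ^ m) + z ^ N * g z) :
    0 ≤ ∑ m ∈ Finset.range N, y m * u m := by
  have key : ∀ r : ℝ, 0 < r → r < 1 → 0 ≤ ∑ m ∈ Finset.range N, r ^ (2 * m) * (y m * u m) := by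
    intro r h0 h1
    have hr : |r| = r := abs_of_pos h0
    have hgc : ContinuousOn g (Metric.sphere 0 |r|) := by
      refine hg.continuousOn.mono ?_
      rw [hr]; exact Metric.sphere_subset_closedBall.trans (Metric.closedBall_subset_ball h1)
    let Y : ℂ → ℂ := fun z => (∑ m ∈ Finset.range N, (y m : ℂ) * z ^ m) + z ^ N * g z
    let f : ℂ → ℂ := fun z => ∑ m ∈ Finset.range N, (u m : ℂ) • (Y z * conj z ^ m)
    have hYc : ∀ m : ℕ, ContinuousOn (fun z => Y z * conj z ^ m) (Metric.sphere 0 |r|) := by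
      intro m; fun_prop
    have hfc : ContinuousOn f (Metric.sphere 0 |r|) := by
      fun_prop
    have hfi : CircleIntegrable f 0 r := hfc.circleIntegrable'
    have hY : ∀ m ∈ Finset.range N, circleAverage (fun z => Y z * conj z ^ m) 0 r
        = (r : ℂ) ^ (2 * m) * y m := by
      intro m hm
      have e : (fun z => Y z * conj z ^ m) = fun z =>
          (∑ k ∈ Finset.range N, (y k : ℂ) • (z ^ k * conj z ^ m)) + z ^ N * g z * conj z ^ m := by
        ext z
        simp only [Y, add_mul, Finset.sum_mul, smul_eq_mul]
        congr 1
        exact Finset.sum_congr rfl fun _ _ => by ring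
      rw [e, circleAverage_fun_add, circleAverage_fun_sum]
      · have h2 : circleAverage (fun z => z ^ N * g z * conj z ^ m) 0 r = 0 := by
          have hmN := Finset.mem_range.1 hm
          obtain ⟨l, rfl⟩ := Nat.exists_eq_add_of_le' hmN.le
          rw [gs_avg_pow hg h0 h1]
          have : l ≠ 0 := by omega
          simp [this]
        rw [h2, add_zero, Finset.sum_eq_single_of_mem m hm]
        · rw [circleAverage_fun_smul, gs_orth h0 h1]; simp [mul_comm]
        · intro k _ hk
          rw [circleAverage_fun_smul, gs_orth h0 h1]; simp [hk]
      · intro k _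
        apply ContinuousOn.circleIntegrable'; fun_prop
      · apply ContinuousOn.circleIntegrable'; fun_prop
      · apply ContinuousOn.circleIntegrable'; fun_prop
    have hf : circleAverage f 0 r
        = ((∑ m ∈ Finset.range N, r ^ (2 * m) * (y m * u m) : ℝ) : ℂ) := by
      simp only [f]
      rw [circleAverage_fun_sum]
      · push_cast
        refine Finset.sum_congr rfl fun m hm => ?_
        rw [circleAverage_fun_smul, hY m hm, smul_eq_mul]; ring
      · intro m _
        apply ContinuousOn.circleIntegrable'
        fun_prop
    have hre : circleAverage ((Complex.reCLM : ℂ →L[ℝ] ℝ) ∘ f) 0 r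
        = ∑ m ∈ Finset.range N, r ^ (2 * m) * (y m * u m) := by
      rw [ContinuousLinearMap.circleAverage_comp_comm _ hfi, hf]
      exact Complex.ofReal_re _
    rw [← hre]
    apply circleAverage_nonneg_of_nonneg
    intro z hz
    have hz1 : ‖z‖ < 1 := by simp at hz; rw [hz, hr]; exact h1
    have hfz : f z = F z * (Complex.normSq (∑ m ∈ Finset.range N, (u m : ℂ) * z ^ m) : ℂ) := by
      rw [← Complex.mul_conj, ← mul_assoc, h z hz1, map_sum, Finset.mul_sum]
      refine Finset.sum_congr rfl fun m _ => ?_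
      simp only [smul_eq_mul, map_mul, map_pow, Complex.conj_ofReal, Y]
      ring
    simp only [Function.comp, Complex.reCLM_apply, hfz, Complex.re_mul_ofReal]
    exact mul_nonneg (hF z hz1) (Complex.normSq_nonneg _)
  have hc : Continuous fun r : ℝ => ∑ m ∈ Finset.range N, r ^ (2 * m) * (y m * u m) := by fun_prop
  have ht : Filter.Tendsto (fun r : ℝ => ∑ m ∈ Finset.range N, r ^ (2 * m) * (y m * u m))
      (nhdsWithin 1 (Set.Iio 1)) (nhds (∑ m ∈ Finset.range N, y m * u m)) := by
    have := (hc.tendsto 1).mono_left (nhdsWithin_le_nhds (s := Set.Iio 1))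
    simpa using this
  refine ge_of_tendsto ht ?_
  have : Set.Ioo (0:ℝ) 1 ∈ nhdsWithin (1:ℝ) (Set.Iio 1) := Ioo_mem_nhdsLT one_pos
  filter_upwards [this] with r hr using key r hr.1 hr.2

lemma gs_split (A : ℝ[X]) (K : ℕ) : ∃ R : ℝ[X], ∀ z : ℂ,
    aeval z A = (∑ m ∈ Finset.range K, (A.coeff m : ℂ) * z ^ m) + z ^ K * aeval z R := by
  have h : (X : ℝ[X]) ^ K ∣ A - ∑ m ∈ Finset.range K, C (A.coeff m) * X ^ m := by
    rw [X_pow_dvd_iff]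
    intro d hd
    rw [coeff_sub, finsetSum_coeff]
    simp [coeff_C_mul, coeff_X_pow, hd]
  obtain ⟨R, hR⟩ := h
  refine ⟨R, fun z => ?_⟩
  have := congrArg (aeval z) hR
  simp only [map_sub, map_sum, map_mul, map_pow, aeval_X, aeval_C] at this
  rw [sub_eq_iff_eq_add] at this
  rw [this, add_comm]; rfl

/-- backward difference expression of a trajectory stored in reversed time as a polynomial -/
noncomputable def gsD (q : ℕ) (δ p : ℝ[X]) (n : ℕ) : ℝ :=
  ∑ i ∈ Finset.range (q + 1), δ.coeff i * p.coeff (n + i)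

lemma gsD_add (q : ℕ) (δ p r : ℝ[X]) (n : ℕ) : gsD q δ (p + r) n = gsD q δ p n + gsD q δ r n := by
  simp [gsD, mul_add, Finset.sum_add_distrib]

lemma gsD_smul (q : ℕ) (δ p : ℝ[X]) (c : ℝ) (n : ℕ) : gsD q δ (c • p) n = c * gsD q δ p n := by
  simp only [gsD, coeff_smul, smul_eq_mul, Finset.mul_sum]
  exact Finset.sum_congr rfl fun _ _ => by ring

lemma gsD_zero (q : ℕ) (δ p : ℝ[X]) (n : ℕ) (h : p.natDegree < n) : gsD q δ p n = 0 := by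
  refine Finset.sum_eq_zero fun i _ => ?_
  rw [coeff_eq_zero_of_natDegree_lt (p := p) (by omega), mul_zero]

lemma gsD_reflect (q : ℕ) (δ p : ℝ[X]) (hδ : δ.natDegree ≤ q) (N m : ℕ) (hp : p.natDegree ≤ N)
    (hm : m ≤ N) : (δ * p.reflect N).coeff m = gsD q δ p (N - m) := by
  rw [coeff_mul, Finset.Nat.sum_antidiagonal_eq_sum_range_succ
    (fun i j => δ.coeff i * (p.reflect N).coeff j)]
  have h1 : ∑ k ∈ Finset.range m.succ, δ.coeff k * (p.reflect N).coeff (m - k)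
      = ∑ k ∈ Finset.range m.succ, δ.coeff k * p.coeff (N - m + k) := by
    refine Finset.sum_congr rfl fun k hk => ?_
    have := Finset.mem_range.1 hk
    rw [coeff_reflect, revAt_le (by omega)]
    congr 2; omega
  rw [h1, gsD]
  have h2 : ∀ L, m.succ ≤ L → ∑ k ∈ Finset.range m.succ, δ.coeff k * p.coeff (N - m + k)
      = ∑ k ∈ Finset.range L, δ.coeff k * p.coeff (N - m + k) := by
    intro L hL
    refine Finset.sum_subset (Finset.range_mono hL) fun k _ hk => ?_
    have : ¬ k < m.succ := fun h => hk (Finset.mem_range.2 h)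
    rw [coeff_eq_zero_of_natDegree_lt (p := p) (by omega), mul_zero]
  have h3 : ∀ L, q + 1 ≤ L → ∑ k ∈ Finset.range (q + 1), δ.coeff k * p.coeff (N - m + k)
      = ∑ k ∈ Finset.range L, δ.coeff k * p.coeff (N - m + k) := by
    intro L hL
    refine Finset.sum_subset (Finset.range_mono hL) fun k _ hk => ?_
    have : ¬ k < q + 1 := fun h => hk (Finset.mem_range.2 h)
    rw [coeff_eq_zero_of_natDegree_lt (p := δ) (by omega), zero_mul]
  rw [h2 (m.succ + (q + 1)) (by omega), h3 (m.succ + (q + 1)) (by omega)]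

lemma gs_passive (q : ℕ) (δ μ : ℝ[X])
    (hδdeg : δ.natDegree ≤ q) (hμdeg : μ.natDegree ≤ q)
    (hpos : ∀ ζ : ℂ, ‖ζ‖ < 1 →
      Polynomial.aeval ζ μ ≠ 0 ∧
        0 < ((Polynomial.aeval ζ δ : ℂ) / Polynomial.aeval ζ μ).re)
    (p : ℝ[X]) (N : ℕ) (hN : p.natDegree ≤ N) :
    0 ≤ ∑ n ∈ Finset.range (N + 1), gsD q δ p n * gsD q μ p n := by
  obtain ⟨R1, h1⟩ := gs_split (μ * p.reflect N) (N + 1)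
  obtain ⟨R2, h2⟩ := gs_split (δ * p.reflect N) (N + 1)
  have := gs_caratheodory (F := fun z => aeval z δ / aeval z μ)
    (g := fun z => aeval z R2 - aeval z δ / aeval z μ * aeval z R1)
    (fun z hz => (hpos z hz).2.le) ?_ (N + 1) (fun m => (μ * p.reflect N).coeff m)
    (fun m => (δ * p.reflect N).coeff m) ?_
  · rw [← Finset.sum_range_reflect]
    refine this.trans_eq (Finset.sum_congr rfl fun m hm => ?_)
    have hm' := Finset.mem_range.1 hm
    rw [gsD_reflect q δ p hδdeg N m hN (by omega), gsD_reflect q μ p hμdeg N m hN (by omega)]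
    congr 2
  · have hd : ∀ A : ℝ[X], Differentiable ℂ fun z : ℂ => aeval z A := fun A => A.differentiable_aeval
    refine (hd R2).differentiableOn.sub (DifferentiableOn.mul ?_ (hd R1).differentiableOn)
    refine (hd δ).differentiableOn.div (hd μ).differentiableOn fun z hz => ?_
    exact (hpos z (by simpa using hz)).1
  · intro z hz
    have hμ := (hpos z hz).1
    have e1 := h1 z
    have e2 := h2 z
    rw [map_mul] at e1 e2
    rw [eq_sub_of_add_eq e1.symm, eq_sub_of_add_eq e2.symm]
    field_simp
    ring

noncomputable def gsB (q : ℕ) (δ μ p r : ℝ[X]) : ℝ :=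
  ∑ n ∈ Finset.range (p.natDegree + r.natDegree + 1),
    (gsD q δ p n * gsD q μ r n + gsD q δ r n * gsD q μ p n) / 2

lemma gsB_eq (q : ℕ) (δ μ p r : ℝ[X]) (K : ℕ) (hK : p.natDegree < K ∨ r.natDegree < K) :
    gsB q δ μ p r = ∑ n ∈ Finset.range K,
      (gsD q δ p n * gsD q μ r n + gsD q δ r n * gsD q μ p n) / 2 := by
  have key : ∀ K L, (p.natDegree < K ∨ r.natDegree < K) → K ≤ L → ∑ n ∈ Finset.range K,
      (gsD q δ p n * gsD q μ r n + gsD q δ r n * gsD q μ p n) / 2 = ∑ n ∈ Finset.range L,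
      (gsD q δ p n * gsD q μ r n + gsD q δ r n * gsD q μ p n) / 2 := by
    intro K L hK hL
    refine Finset.sum_subset (Finset.range_mono hL) fun k _ hk => ?_
    have : ¬ k < K := fun h => hk (Finset.mem_range.2 h)
    rcases hK with h | h
    · rw [gsD_zero q δ p k (by omega), gsD_zero q μ p k (by omega)]; simp
    · rw [gsD_zero q δ r k (by omega), gsD_zero q μ r k (by omega)]; simp
  rw [gsB, key _ (p.natDegree + r.natDegree + 1 + K) (by omega) (by omega),
    key K (p.natDegree + r.natDegree + 1 + K) hK (by omega)]

lemma gsB_step (q : ℕ) (δ μ p : ℝ[X]) (c : ℝ) :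
    gsB q δ μ (X * p + C c) (X * p + C c) = gsB q δ μ p p
      + gsD q δ (X * p + C c) 0 * gsD q μ (X * p + C c) 0 := by
  have hD : ∀ δ : ℝ[X], ∀ n, gsD q δ (X * p + C c) (n + 1) = gsD q δ p n := by
    intro δ n
    refine Finset.sum_congr rfl fun i _ => ?_
    rw [show n + 1 + i = (n + i) + 1 by ring]
    simp [coeff_X_mul, coeff_C_succ]
  rw [gsB_eq q δ μ _ _ ((X * p + C c).natDegree + p.natDegree + 1 + 1) (by omega),
    gsB_eq q δ μ p p ((X * p + C c).natDegree + p.natDegree + 1) (by omega),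
    Finset.sum_range_succ']
  simp only [hD]
  ring

lemma gs_storage (q : ℕ) (hq : 1 ≤ q) (δ μ : ℝ[X])
    (hδdeg : δ.natDegree ≤ q) (hμdeg : μ.natDegree ≤ q)
    (hpos : ∀ ζ : ℂ, ‖ζ‖ < 1 →
      Polynomial.aeval ζ μ ≠ 0 ∧
        0 < ((Polynomial.aeval ζ δ : ℂ) / Polynomial.aeval ζ μ).re) :
    ∃ g : (Fin q → ℝ) →ₗ[ℝ] (Fin q → ℝ) →ₗ[ℝ] ℝ, (∀ x y, g x y = g y x) ∧ (∀ x, 0 ≤ g x x) ∧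
      ∀ w : ℕ → ℝ, g (fun i => w (i + 1)) (fun i => w (i + 1)) - g (fun i => w i) (fun i => w i)
        ≤ (∑ i ∈ Finset.range (q + 1), δ.coeff i * w (q - i)) *
          (∑ i ∈ Finset.range (q + 1), μ.coeff i * w (q - i)) := by
  let c : PreInnerProductSpace.Core ℝ ℝ[X] :=
    { inner := gsB q δ μ
      conj_inner_symm := fun p r => by
        simp only [conj_trivial]
        rw [gsB_eq q δ μ r p (p.natDegree + r.natDegree + 1) (by omega), gsB]
        exact Finset.sum_congr rfl fun _ _ => by ring
      re_inner_nonneg := fun p => by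
        simp only [RCLike.re_to_real]
        rw [gsB_eq q δ μ p p (p.natDegree + 1) (by omega)]
        refine (gs_passive q δ μ hδdeg hμdeg hpos p p.natDegree le_rfl).trans_eq ?_
        exact Finset.sum_congr rfl fun _ _ => by ring
      add_left := fun p r s => by
        rw [gsB_eq q δ μ (p + r) s (s.natDegree + 1) (by omega),
          gsB_eq q δ μ p s (s.natDegree + 1) (by omega),
          gsB_eq q δ μ r s (s.natDegree + 1) (by omega), ← Finset.sum_add_distrib]
        simp only [gsD_add]
        exact Finset.sum_congr rfl fun _ _ => by ring
      smul_left := fun p s a => by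
        rw [gsB_eq q δ μ (a • p) s (s.natDegree + 1) (by omega),
          gsB_eq q δ μ p s (s.natDegree + 1) (by omega), Finset.mul_sum]
        simp only [gsD_smul, conj_trivial]
        exact Finset.sum_congr rfl fun _ _ => by ring }
  let π : ℝ[X] →ₗ[ℝ] (Fin q → ℝ) := LinearMap.pi fun i => lcoeff ℝ (q - 1 - i)
  have hπ : ∀ p i, π p i = p.coeff (q - 1 - i) := fun p i => rfl
  have hsurj : Function.Surjective π := by
    intro x
    refine ⟨∑ i : Fin q, monomial (q - 1 - i) (x i), ?_⟩
    ext j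
    rw [hπ, finsetSum_coeff, Finset.sum_eq_single j]
    · simp
    · intro i _ hij
      rw [coeff_monomial, if_neg]
      intro h
      apply hij
      ext
      have := i.2
      have := j.2
      omega
    · simp
  obtain ⟨g, hg1, hg2, hg3, hg4⟩ := gs_inf_form c π hsurj
  refine ⟨g, hg1, hg2, fun w => ?_⟩
  apply le_of_forall_pos_le_add
  intro ε hε
  obtain ⟨p, hp, hpe⟩ := hg4 (fun i => w i) ε hε
  have h3 := hg3 (X * p + C (w q))
  have hcoef : ∀ i ≤ q, (X * p + C (w q)).coeff i = w (q - i) := by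
    intro i hi
    rcases i with _ | i
    · simp
    · have := congrFun hp ⟨q - 1 - i, by omega⟩
      rw [hπ] at this
      simp only at this
      rw [show q - 1 - (q - 1 - i) = i by omega] at this
      simp only [coeff_add, coeff_X_mul, coeff_C_succ, add_zero]
      rw [this]
      congr 1; omega
  have hnew : π (X * p + C (w q)) = fun i : Fin q => w ((i : ℕ) + 1) := by
    ext i
    have := i.2
    rw [hπ, hcoef _ (by omega)]
    congr 1; omega
  have hD : ∀ δ : ℝ[X], gsD q δ (X * p + C (w q)) 0
      = ∑ i ∈ Finset.range (q + 1), δ.coeff i * w (q - i) := by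
    intro δ
    refine Finset.sum_congr rfl fun i hi => ?_
    have := Finset.mem_range.1 hi
    rw [zero_add, hcoef i (by omega)]
  have h5 : c.inner (X * p + C (w q)) (X * p + C (w q)) = c.inner p p + _ :=
    gsB_step q δ μ p (w q)
  rw [hnew, h5, hD, hD] at h3
  linarith

/-- the shift on sequences -/
noncomputable def gsShift : (ℕ → ℝ) →ₗ[ℝ] (ℕ → ℝ) := LinearMap.funLeft ℝ ℝ Nat.succ

lemma gsShift_pow (k : ℕ) (w : ℕ → ℝ) (n : ℕ) : (gsShift ^ k) w n = w (n + k) := by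
  induction k generalizing n with
  | zero => simp
  | succ k ih =>
    rw [pow_succ', Module.End.mul_apply]
    change (gsShift ^ k) w (n + 1) = _
    rw [ih]; congr 1; ring

lemma gs_aeval_shift (q : ℕ) (δ : ℝ[X]) (hδ : δ.natDegree ≤ q) (w : ℕ → ℝ) (n : ℕ) :
    (aeval gsShift (δ.reflect q)) w n
      = ∑ i ∈ Finset.range (q + 1), δ.coeff i * w (n + (q - i)) := by
  have hd : (δ.reflect q).natDegree < q + 1 := by
    rw [Nat.lt_succ_iff, natDegree_le_iff_coeff_eq_zero]
    intro N hN
    rw [coeff_reflect, revAt_eq_self_of_lt hN]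
    exact coeff_eq_zero_of_natDegree_lt (by omega)
  rw [aeval_eq_sum_range' hd, LinearMap.sum_apply, Finset.sum_apply, ← Finset.sum_range_reflect]
  refine Finset.sum_congr rfl fun i hi => ?_
  have := Finset.mem_range.1 hi
  rw [LinearMap.smul_apply, Pi.smul_apply, gsShift_pow, smul_eq_mul, coeff_reflect,
    revAt_le (by omega)]
  congr 2 <;> omega

lemma gs_coprime (q : ℕ) (δ μ : ℝ[X]) (hδdeg : δ.natDegree ≤ q) (hμdeg : μ.natDegree ≤ q)
    (hdeg : δ.natDegree = q ∨ μ.natDegree = q)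
    (hδ0 : δ ≠ 0) (hμ0 : μ ≠ 0)
    (hno : ∀ z : ℂ, ¬ (Polynomial.aeval z δ = 0 ∧ Polynomial.aeval z μ = 0)) :
    IsCoprime (δ.reflect q) (μ.reflect q) := by
  rw [Polynomial.isCoprime_iff_aeval_ne_zero_of_isAlgClosed ℝ ℂ]
  intro z
  by_contra! h
  rcases eq_or_ne z 0 with rfl | hz
  · have e : ∀ A : ℝ[X], aeval (0 : ℂ) (A.reflect q) = (A.coeff q : ℂ) := by
      intro A
      rw [← coeff_zero_eq_aeval_zero', coeff_reflect, revAt_le (Nat.zero_le _)]; rfl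
    rw [e, e] at h
    norm_cast at h
    rcases hdeg with h' | h'
    · exact hδ0 (leadingCoeff_eq_zero.1 (by rw [leadingCoeff, h']; exact h.1))
    · exact hμ0 (leadingCoeff_eq_zero.1 (by rw [leadingCoeff, h']; exact h.2))
  · let _ : Invertible z⁻¹ := invertibleOfNonzero (inv_ne_zero hz)
    have e : ⅟(z⁻¹) = z := by rw [invOf_eq_inv, inv_inv]
    have k : ∀ A : ℝ[X], A.natDegree ≤ q → aeval z (A.reflect q) = 0 → aeval z⁻¹ A = 0 := by
      intro A hA h
      rw [aeval_def] at h ⊢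
      rw [← eval₂_reflect_eq_zero_iff _ z⁻¹ q A hA, e]; exact h
    exact hno z⁻¹ ⟨k δ hδdeg h.1, k μ hμdeg h.2⟩

lemma gs_posdef (q : ℕ) (δ μ : ℝ[X])
    (hδdeg : δ.natDegree ≤ q) (hμdeg : μ.natDegree ≤ q)
    (hδ0 : δ.coeff 0 ≠ 0) (hμ0 : μ.coeff 0 ≠ 0)
    (hco : IsCoprime (δ.reflect q) (μ.reflect q))
    (g : (Fin q → ℝ) →ₗ[ℝ] (Fin q → ℝ) →ₗ[ℝ] ℝ) (hg : ∀ x, 0 ≤ g x x)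
    (hstep : ∀ w : ℕ → ℝ,
      g (fun i => w (i + 1)) (fun i => w (i + 1)) - g (fun i => w i) (fun i => w i)
        ≤ (∑ i ∈ Finset.range (q + 1), δ.coeff i * w (q - i)) *
          (∑ i ∈ Finset.range (q + 1), μ.coeff i * w (q - i)))
    (x : Fin q → ℝ) (hx : g x x = 0) : x = 0 := by
  let E : LinearRecurrence ℝ := ⟨q, fun i => - μ.coeff (q - i) / μ.coeff 0⟩
  let w : ℕ → ℝ := E.mkSol x
  have hw0 : (fun i : Fin q => w i) = x := funext fun i => E.mkSol_eq_init x i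
  have hμw : ∀ n, ∑ i ∈ Finset.range (q + 1), μ.coeff i * w (n + (q - i)) = 0 := by
    intro n
    have h := E.is_sol_mkSol x n
    change w (n + q) = ∑ i : Fin q, (- μ.coeff (q - i) / μ.coeff 0) * w (n + i) at h
    rw [← Finset.sum_range_reflect, Finset.sum_range_succ, Finset.sum_range]
    simp only [add_tsub_cancel_right, tsub_self, tsub_zero]
    rw [h, Finset.mul_sum, ← Finset.sum_add_distrib]
    refine Finset.sum_eq_zero fun i _ => ?_
    have := i.2
    rw [show q - (q - (i : ℕ)) = i by omega]
    field_simp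
    ring
  have hwin : ∀ n, g (fun i => w (n + i)) (fun i => w (n + i)) = 0 := by
    intro n
    induction n with
    | zero => simpa [hw0] using hx
    | succ n ih =>
      have h := hstep fun t => w (n + t)
      rw [hμw n, mul_zero, ih, sub_zero] at h
      have e : (fun i : Fin q => w (n + ((i : ℕ) + 1))) = fun i : Fin q => w (n + 1 + i) := by
        ext i; congr 1; ring
      rw [e] at h
      exact le_antisymm h (hg _)
  have hδw : ∀ n, ∑ i ∈ Finset.range (q + 1), δ.coeff i * w (n + (q - i)) = 0 := by
    intro n
    by_contra hd
    set d := ∑ i ∈ Finset.range (q + 1), δ.coeff i * w (n + (q - i)) with hddef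
    have key : ∀ c : ℝ, 0 ≤ (d + δ.coeff 0 * c) * (μ.coeff 0 * c) := by
      intro c
      have h := hstep fun t => w (n + t) + if t = q then c else 0
      have e : ∀ A : ℝ[X], ∑ i ∈ Finset.range (q + 1),
          A.coeff i * (w (n + (q - i)) + if q - i = q then c else 0)
          = ∑ i ∈ Finset.range (q + 1), A.coeff i * w (n + (q - i)) + A.coeff 0 * c := by
        intro A
        simp only [mul_add, Finset.sum_add_distrib]
        congr 1
        rw [Finset.sum_eq_single 0]
        · simp
        · intro i hi hi0
          have := Finset.mem_range.1 hi
          rw [if_neg (by omega), mul_zero]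
        · simp
      have e2 : (fun i : Fin q => w (n + i) + if (i : ℕ) = q then c else 0)
          = fun i : Fin q => w (n + i) := by
        ext i
        have := i.2
        rw [if_neg (by omega), add_zero]
      rw [e, e, hμw n, zero_add, e2, hwin n, sub_zero] at h
      exact (hg _).trans h
    set a := δ.coeff 0
    set m := μ.coeff 0
    have ht : 0 < 1 + |a * m| := by positivity
    have h := key (-(d * m) / (1 + |a * m|))
    have e : (d + a * (-(d * m) / (1 + |a * m|))) * (m * (-(d * m) / (1 + |a * m|)))
        = - (d ^ 2 * m ^ 2 * (1 + |a * m| - a * m)) / (1 + |a * m|) ^ 2 := by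
      field_simp
      ring
    rw [e] at h
    have h1 : 0 < 1 + |a * m| - a * m := by linarith [le_abs_self (a * m)]
    have h2 : 0 < d ^ 2 * m ^ 2 * (1 + |a * m| - a * m) := by positivity
    have h3 : - (d ^ 2 * m ^ 2 * (1 + |a * m| - a * m)) / (1 + |a * m|) ^ 2 < 0 :=
      div_neg_of_neg_of_pos (by linarith) (by positivity)
    linarith
  have hz : w = 0 := by
    obtain ⟨a, b, hab⟩ := hco
    have h1 : aeval gsShift (δ.reflect q) w = 0 := by
      ext n; rw [gs_aeval_shift q δ hδdeg, hδw]; rfl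
    have h2 : aeval gsShift (μ.reflect q) w = 0 := by
      ext n; rw [gs_aeval_shift q μ hμdeg, hμw]; rfl
    have := congrArg (fun A => aeval gsShift A w) hab
    simpa [h1, h2] using this.symm
  rw [← hw0, hz]; rfl

theorem dahlquist_G_stability (q : ℕ) (hq : 1 ≤ q)
    (δ μ : Polynomial ℝ)
    (hδdeg : δ.natDegree ≤ q) (hμdeg : μ.natDegree ≤ q)
    (hdeg : δ.natDegree = q ∨ μ.natDegree = q)
    (hnocommonroot : ∀ z : ℂ,
      ¬ (Polynomial.aeval z δ = 0 ∧ Polynomial.aeval z μ = 0))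
    (hpos : ∀ ζ : ℂ, ‖ζ‖ < 1 →
      Polynomial.aeval ζ μ ≠ 0 ∧
        0 < ((Polynomial.aeval ζ δ : ℂ) / Polynomial.aeval ζ μ).re) :
    ∃ G : Matrix (Fin q) (Fin q) ℝ, G.IsSymm ∧ G.PosDef ∧
      ∀ (V : Type*) [AddCommGroup V] [Module ℝ V] (b : V →ₗ[ℝ] V →ₗ[ℝ] ℝ),
        (∀ v w : V, b v w = b w v) → (∀ v : V, 0 ≤ b v v) →
        ∀ w : ℕ → V,
          (∑ i : Fin q, ∑ j : Fin q, G i j * b (w (i.1 + 1)) (w (j.1 + 1)))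
              - ∑ i : Fin q, ∑ j : Fin q, G i j * b (w i.1) (w j.1)
            ≤ b (∑ i ∈ Finset.range (q + 1), δ.coeff i • w (q - i))
                (∑ j ∈ Finset.range (q + 1), μ.coeff j • w (q - j)) := by
  have hp0 := hpos 0 (by simp)
  have e0 : ∀ A : ℝ[X], aeval (0 : ℂ) A = (A.coeff 0 : ℂ) := by
    intro A
    rw [← coeff_zero_eq_aeval_zero']; rfl
  have hμ0 : μ.coeff 0 ≠ 0 := by
    intro h; apply hp0.1; rw [e0, h]; simp
  have hδ0 : δ.coeff 0 ≠ 0 := by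
    intro h
    have := hp0.2
    rw [e0 δ, h] at this
    simp at this
  have hco := gs_coprime q δ μ hδdeg hμdeg hdeg (fun h => hδ0 (by simp [h]))
    (fun h => hμ0 (by simp [h])) hnocommonroot
  obtain ⟨g, hsymm, hnn, hstep⟩ := gs_storage q hq δ μ hδdeg hμdeg hpos
  have hpd := gs_posdef q δ μ hδdeg hμdeg hδ0 hμ0 hco g hnn hstep
  let G : Matrix (Fin q) (Fin q) ℝ :=
    Matrix.of fun i j => g (Pi.single i 1) (Pi.single j 1)
  have hG : ∀ x y : Fin q → ℝ, g x y = ∑ i, ∑ j, G i j * (x i * y j) := by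
    intro x y
    conv_lhs => rw [pi_eq_sum_univ' x, pi_eq_sum_univ' y]
    simp only [map_sum, LinearMap.sum_apply, map_smul, LinearMap.smul_apply, smul_eq_mul]
    rw [Finset.sum_comm]
    refine Finset.sum_congr rfl fun i _ => ?_
    rw [Finset.mul_sum]
    refine Finset.sum_congr rfl fun j _ => ?_
    simp only [G, Matrix.of_apply]
    ring
  have hGs : G.IsSymm := by
    ext i j; simp [G, hsymm]
  refine ⟨G, hGs, ?_, ?_⟩
  · refine Matrix.PosDef.of_dotProduct_mulVec_pos ?_ ?_
    · rw [Matrix.IsHermitian, Matrix.conjTranspose_eq_transpose_of_trivial]; exact hGs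
    · intro x hx
      have h1 : 0 < g x x := lt_of_le_of_ne (hnn x) fun h => hx (hpd x h.symm)
      refine h1.trans_eq ?_
      rw [hG]
      simp only [dotProduct, Matrix.mulVec, Pi.star_apply, star_trivial, Finset.mul_sum]
      exact Finset.sum_congr rfl fun i _ => Finset.sum_congr rfl fun j _ => by ring
  · intro V _ _ b hs hp w
    obtain ⟨m, c, hc⟩ := gs_gram b hs hp w q
    have h1 : ∑ i : Fin q, ∑ j : Fin q, G i j * b (w (i.1 + 1)) (w (j.1 + 1))
        = ∑ k, g (fun i => c k (i + 1)) (fun i => c k (i + 1)) := by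
      simp only [hG]
      symm
      rw [Finset.sum_comm]
      refine Finset.sum_congr rfl fun i _ => ?_
      rw [Finset.sum_comm]
      refine Finset.sum_congr rfl fun j _ => ?_
      rw [hc _ (by omega) _ (by omega), Finset.mul_sum]
    have h2 : ∑ i : Fin q, ∑ j : Fin q, G i j * b (w i.1) (w j.1)
        = ∑ k, g (fun i => c k i) (fun i => c k i) := by
      simp only [hG]
      symm
      rw [Finset.sum_comm]
      refine Finset.sum_congr rfl fun i _ => ?_
      rw [Finset.sum_comm]
      refine Finset.sum_congr rfl fun j _ => ?_
      rw [hc _ (by omega) _ (by omega), Finset.mul_sum]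
    have h3 : b (∑ i ∈ Finset.range (q + 1), δ.coeff i • w (q - i))
          (∑ j ∈ Finset.range (q + 1), μ.coeff j • w (q - j))
        = ∑ k, (∑ i ∈ Finset.range (q + 1), δ.coeff i * c k (q - i)) *
          (∑ i ∈ Finset.range (q + 1), μ.coeff i * c k (q - i)) := by
      simp only [Finset.sum_mul_sum]
      symm
      rw [Finset.sum_comm, map_sum b, LinearMap.sum_apply]
      refine Finset.sum_congr rfl fun i hi => ?_
      rw [Finset.sum_comm, map_sum]
      refine Finset.sum_congr rfl fun j hj => ?_
      simp only [map_smul, LinearMap.smul_apply, smul_eq_mul]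
      rw [hc _ (by omega) _ (by omega), Finset.mul_sum, Finset.mul_sum]
      exact Finset.sum_congr rfl fun k _ => by ring
    rw [h1, h2, h3, ← Finset.sum_sub_distrib]
    exact Finset.sum_le_sum fun k _ => hstep (c k)
end

section
/- Let 1 ≤ p ≤ q ≤ 5 be integers, let T > 0 and τ > 0 with qτ ≤ T, and let y : ℝ → ℝ be p times continuously differentiable on [0, T]. Assume there is a locally integrable function g : ℝ → ℝ such that y^{(p)}(b) − y^{(p)}(a) = ∫_a^b g(s) ds for all 0 ≤ a ≤ b ≤ T. Then for every t* ∈ [qτ, T]: (1/τ) Σ_{i=0}^{q} δ_i y(t* − iτ) − y'(t*) = τ^p ∫_0^q K(s) g(t* − sτ) ds, where K(s) = −(1/p!) Σ_{i=0}^{q} δ_i (min(s − i, 0))^p and δ_0,…,δ_q are the BDF-q coefficients. -/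
open MeasureTheory

/-- The BDF-`q` generating polynomial `δ(ζ) = Σ_{l=1}^{q} (1/l)(1−ζ)^l`, over `ℝ`. -/
noncomputable def bdfPoly (q : ℕ) : Polynomial ℝ :=
  ∑ l ∈ Finset.Icc 1 q, Polynomial.C ((l : ℝ)⁻¹) * (1 - Polynomial.X) ^ l

/-- The BDF-`q` coefficients `δ_j`, defined by `δ(ζ) = Σ_{j=0}^{q} δ_j ζ^j`. -/
noncomputable def bdfCoeff (q j : ℕ) : ℝ := (bdfPoly q).coeff j

theorem loc_ii {g : ℝ → ℝ} (hg : LocallyIntegrable g volume) (a b : ℝ) :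
    IntervalIntegrable g volume a b :=
  intervalIntegrable_iff.mpr <|
    (hg.integrableOn_isCompact isCompact_uIcc).mono_set Set.uIoc_subset_uIcc

theorem bdfCoeff_eq (q j : ℕ) : bdfCoeff q j =
    ∑ l ∈ Finset.Icc 1 q, (l : ℝ)⁻¹ * ((-1) ^ l * ((-1) ^ (l - j) * (l.choose j : ℝ))) := by
  unfold bdfCoeff bdfPoly
  rw [Polynomial.finsetSum_coeff]
  refine Finset.sum_congr rfl fun l _ => ?_
  have h : (1 - Polynomial.X : Polynomial ℝ) ^ l
      = Polynomial.C ((-1) ^ l) * (Polynomial.X + Polynomial.C (-1)) ^ l := by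
    rw [map_pow, ← mul_pow]
    congr 1
    simp only [map_neg, map_one]
    ring
  rw [h, Polynomial.coeff_C_mul, Polynomial.coeff_C_mul, Polynomial.coeff_X_add_C_pow]

set_option maxHeartbeats 4000000 in
theorem bdf_moment (q k : ℕ) (hk : k ≤ q) (hq0 : 1 ≤ q) (hq : q ≤ 5) :
    ∑ i ∈ Finset.range (q + 1), bdfCoeff q i * (-(i : ℝ)) ^ k = if k = 1 then 1 else 0 := by
  simp only [bdfCoeff_eq]
  interval_cases q <;>
    simp only [Finset.sum_range_succ, Finset.sum_Icc_succ_top, Finset.Icc_self, Finset.sum_range_zero,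
      Finset.sum_singleton, Nat.one_le_ofNat, Nat.choose, Nat.reduceAdd, Nat.reduceLeDiff] <;>
    interval_cases k <;> norm_num [Nat.choose]

theorem ac_congr {f h : ℝ → ℝ} {a b : ℝ} (hf : AbsolutelyContinuousOnInterval f a b)
    (hfh : Set.EqOn f h (Set.uIcc a b)) : AbsolutelyContinuousOnInterval h a b := by
  rw [absolutelyContinuousOnInterval_iff] at hf ⊢
  intro ε hε
  obtain ⟨δ, hδ, H⟩ := hf ε hε
  refine ⟨δ, hδ, fun E hE hE2 => ?_⟩
  refine lt_of_eq_of_lt ?_ (H E hE hE2)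
  refine Finset.sum_congr rfl fun i hi => ?_
  have := hE.1 i hi
  rw [hfh this.1, hfh this.2]

open Set in
theorem taylor_ac_remainder (p : ℕ) (T : ℝ) (hT : 0 < T) (y g : ℝ → ℝ)
    (hy : ContDiffOn ℝ p y (Set.Icc 0 T))
    (hg : LocallyIntegrable g volume)
    (hac : ∀ a b : ℝ, 0 ≤ a → a ≤ b → b ≤ T →
      iteratedDerivWithin p y (Set.Icc 0 T) b - iteratedDerivWithin p y (Set.Icc 0 T) a
        = ∫ s in a..b, g s) (t x : ℝ) (ht : t ∈ Set.Icc 0 T) (hx : x ∈ Set.Icc 0 T) :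
    y x - taylorWithinEval y p (Set.Icc 0 T) t x
      = ∫ s in t..x, ((p.factorial : ℝ)⁻¹ * (x - s) ^ p) * g s := by
  have hu : UniqueDiffOn ℝ (Icc 0 T) := uniqueDiffOn_Icc hT
  have huI : uIcc 0 T = Icc 0 T := uIcc_of_le hT.le
  have hgi : ∀ a b, IntervalIntegrable g volume a b := loc_ii hg
  have hDp : ∀ s ∈ Icc 0 T, iteratedDerivWithin p y (Icc 0 T) s
      = iteratedDerivWithin p y (Icc 0 T) 0 + ∫ u in (0:ℝ)..s, g u := by
    intro s hs
    rw [← hac 0 s le_rfl hs.1 hs.2]; ring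
  have acDp : AbsolutelyContinuousOnInterval (iteratedDerivWithin p y (Icc 0 T)) 0 T := by
    have h1 := (hgi 0 T).absolutelyContinuousOnInterval_intervalIntegral (c := 0) (by simp)
    have h2 : AbsolutelyContinuousOnInterval
        (fun _ : ℝ => iteratedDerivWithin p y (Icc 0 T) 0) 0 T :=
      ContDiffOn.absolutelyContinuousOnInterval (by fun_prop)
    refine ac_congr (h2.add h1) fun s hs => ?_
    rw [huI] at hs
    exact (hDp s hs).symm
  have acD : ∀ k ≤ p, AbsolutelyContinuousOnInterval (iteratedDerivWithin k y (Icc 0 T)) 0 T := by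
    intro k hk
    rcases hk.eq_or_lt with rfl | hk
    · exact acDp
    · have := hy.of_le (m := (k + 1 : ℕ)) (by exact_mod_cast hk)
      apply ContDiffOn.absolutelyContinuousOnInterval
      rw [huI]
      exact ((contDiffOn_nat_succ_iff_contDiffOn_one_iteratedDerivWithin hu).1 this).2
  have acF : ∀ k ≤ p,
      AbsolutelyContinuousOnInterval (fun s => taylorWithinEval y k (Icc 0 T) s x) 0 T := by
    intro k
    induction k with
    | zero =>
      intro _
      have := acD 0 (Nat.zero_le _)
      simpa using this
    | succ k ih =>
      intro hk
      simp only [taylorWithinEval_succ, smul_eq_mul]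
      refine (ih (by omega)).add (AbsolutelyContinuousOnInterval.mul ?_ (acD _ hk))
      exact ContDiffOn.absolutelyContinuousOnInterval (by fun_prop)
  have hsub : uIcc t x ⊆ uIcc 0 T := by
    rw [huI]; exact uIcc_subset_Icc ht hx
  have hF := ((acF p le_rfl).mono hsub).integral_deriv_eq_sub
  simp only [taylorWithinEval_self] at hF
  rw [← hF]
  apply intervalIntegral.integral_congr_ae
  have e0 : ∀ᵐ s : ℝ, s ≠ 0 := by simp [ae_iff, measure_singleton]
  have eT : ∀ᵐ s : ℝ, s ≠ T := by simp [ae_iff, measure_singleton]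
  filter_upwards [LocallyIntegrable.ae_hasDerivAt_integral hg, e0, eT] with s hs hs0 hsT hsm
  have hsI : s ∈ Icc 0 T := huI ▸ hsub (uIoc_subset_uIcc hsm)
  have hsO : s ∈ Ioo 0 T := ⟨lt_of_le_of_ne hsI.1 hs0.symm, lt_of_le_of_ne hsI.2 hsT⟩
  have hD : HasDerivWithinAt (iteratedDerivWithin p y (Icc 0 T)) (g s) (Icc 0 T) s :=
    ((hs 0).const_add (iteratedDerivWithin p y (Icc 0 T) 0)).hasDerivWithinAt.congr hDp (hDp s hsI)
  have hG := hasDerivWithinAt_taylorWithinEval (x := x) hu self_mem_nhdsWithin hsI Subset.rfl hy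
    hD.differentiableWithinAt
  rw [iteratedDerivWithin_succ, hD.derivWithin (hu s hsI)] at hG
  exact (hG.hasDerivAt (Icc_mem_nhds hsO.1 hsO.2)).deriv

theorem kernel_piece (p q i : ℕ) (hp : 1 ≤ p) (hi : i ≤ q) (τ : ℝ) (hτ : 0 < τ) (g : ℝ → ℝ)
    (hg : LocallyIntegrable g volume) (t : ℝ) :
    ∫ s in t..(t - i * τ), ((p.factorial : ℝ)⁻¹ * (t - i * τ - s) ^ p) * g s
      = τ ^ (p + 1) * ∫ s in (0 : ℝ)..(q : ℝ),
        (-(1 / (p.factorial : ℝ)) * (min (s - i) 0) ^ p) * g (t - s * τ) := by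
  have hcomp : ∀ a b : ℝ, IntervalIntegrable (fun s => g (t - s * τ)) volume a b := by
    intro a b
    have h := (loc_ii hg (t - τ * a) (t - τ * b)).comp_sub_left t
    have h2 := h.comp_mul_left (c := τ)
    simpa [hτ.ne', mul_comm] using h2
  have hint : ∀ a b : ℝ, IntervalIntegrable (fun s : ℝ =>
      (-(1 / (p.factorial : ℝ)) * (min (s - i) 0) ^ p) * g (t - s * τ)) volume a b := by
    intro a b
    exact (hcomp a b).continuousOn_mul (by fun_prop)
  rw [← intervalIntegral.integral_add_adjacent_intervals (hint 0 i) (hint i q)]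
  have z : ∫ s in (i : ℝ)..(q : ℝ),
      (-(1 / (p.factorial : ℝ)) * (min (s - i) 0) ^ p) * g (t - s * τ) = 0 := by
    rw [← intervalIntegral.integral_zero (a := (i : ℝ)) (b := (q : ℝ)) (μ := volume)]
    apply intervalIntegral.integral_congr
    intro s hs
    rw [Set.uIcc_of_le (by exact_mod_cast hi)] at hs
    have : min (s - i) 0 = 0 := min_eq_right (by linarith [hs.1])
    have hp0 : p ≠ 0 := by omega
    simp [this, hp0]
  rw [z, add_zero]
  have e := intervalIntegral.integral_comp_sub_mul
    (f := fun s => ((p.factorial : ℝ)⁻¹ * (t - i * τ - s) ^ p) * g s) (a := 0) (b := i) hτ.ne' t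
  have e2 : ∫ s in t..(t - i * τ), ((p.factorial : ℝ)⁻¹ * (t - i * τ - s) ^ p) * g s
      = -τ * ∫ s in (0 : ℝ)..i,
        ((p.factorial : ℝ)⁻¹ * (t - i * τ - (t - τ * s)) ^ p) * g (t - τ * s) := by
    rw [e, intervalIntegral.integral_symm, smul_eq_mul, mul_zero, sub_zero, mul_comm (i : ℝ) τ]
    field_simp
  rw [e2, ← intervalIntegral.integral_const_mul, ← intervalIntegral.integral_const_mul]
  apply intervalIntegral.integral_congr
  intro s hs
  rw [Set.uIcc_of_le (by positivity)] at hs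
  have : min (s - i) 0 = s - i := min_eq_left (by linarith [hs.2])
  simp only [this]
  rw [show t - i * τ - (t - τ * s) = τ * (s - i) by ring, mul_pow, mul_comm τ s]
  ring

/-- Peano-kernel representation of the consistency error of the BDF-`q`
discrete time derivative. If `y` is `p` times continuously differentiable on `[0,T]`
(`1 ≤ p ≤ q ≤ 5`) with `y^{(p)}` absolutely continuous with a.e. derivative `g`
(a locally integrable function), then for `t* ∈ [qτ, T]`:
`(1/τ) Σ_{i=0}^q δ_i y(t*−iτ) − y'(t*) = τ^p ∫_0^q K(s) g(t*−sτ) ds`, where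
`K(s) = −(1/p!) Σ_{i=0}^q δ_i (min(s−i,0))^p`. -/
theorem bdf_peano_kernel (p q : ℕ) (hp : 1 ≤ p) (hpq : p ≤ q) (hq : q ≤ 5)
    (T τ : ℝ) (hT : 0 < T) (hτ : 0 < τ) (hqτT : (q : ℝ) * τ ≤ T)
    (y g : ℝ → ℝ)
    (hy : ContDiffOn ℝ p y (Set.Icc 0 T))
    (hg : LocallyIntegrable g volume)
    (hac : ∀ a b : ℝ, 0 ≤ a → a ≤ b → b ≤ T →
      iteratedDerivWithin p y (Set.Icc 0 T) b - iteratedDerivWithin p y (Set.Icc 0 T) a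
        = ∫ s in a..b, g s)
    (tstar : ℝ) (ht1 : (q : ℝ) * τ ≤ tstar) (ht2 : tstar ≤ T) :
    (1 / τ) * (∑ i ∈ Finset.range (q + 1), bdfCoeff q i * y (tstar - i * τ))
        - derivWithin y (Set.Icc 0 T) tstar
      = τ ^ p * ∫ s in (0 : ℝ)..(q : ℝ),
          (-(1 / (p.factorial : ℝ)) *
              ∑ i ∈ Finset.range (q + 1), bdfCoeff q i * (min (s - i) 0) ^ p) *
            g (tstar - s * τ) := by
  have hq0 : 1 ≤ q := hp.trans hpq
  have hq0' : (0 : ℝ) ≤ (q : ℝ) * τ := by positivity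
  have htI : tstar ∈ Set.Icc 0 T := ⟨hq0'.trans ht1, ht2⟩
  have hcomp : ∀ a b : ℝ, IntervalIntegrable (fun s => g (tstar - s * τ)) volume a b := by
    intro a b
    have h := (loc_ii hg (tstar - τ * a) (tstar - τ * b)).comp_sub_left tstar
    have h2 := h.comp_mul_left (c := τ)
    simpa [hτ.ne', mul_comm] using h2
  set J : ℕ → ℝ := fun i => ∫ s in (0 : ℝ)..(q : ℝ),
        (-(1 / (p.factorial : ℝ)) * (min (s - i) 0) ^ p) * g (tstar - s * τ) with hJ
  have hR : ∀ i ∈ Finset.range (q + 1), y (tstar - i * τ)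
      = (∑ k ∈ Finset.range (p + 1), (((k.factorial : ℝ)⁻¹ * τ ^ k *
          iteratedDerivWithin k y (Set.Icc 0 T) tstar) * (-(i : ℝ)) ^ k)) + τ ^ (p + 1) * J i := by
    intro i hi
    have hiq : i ≤ q := by simpa [Nat.lt_succ_iff] using hi
    have hiq' : (i : ℝ) * τ ≤ q * τ := by gcongr
    have hi0 : (0 : ℝ) ≤ i * τ := by positivity
    have h := taylor_ac_remainder p T hT y g hy hg hac tstar (tstar - i * τ) htI
      ⟨by linarith, by linarith⟩
    rw [kernel_piece p q i hp hiq τ hτ g hg tstar, taylor_within_apply] at h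
    rw [sub_eq_iff_eq_add'] at h
    rw [h]
    congr 1
    refine Finset.sum_congr rfl fun k _ => ?_
    rw [show tstar - i * τ - tstar = τ * (-(i : ℝ)) by ring, mul_pow, smul_eq_mul]
    ring
  have hsum : ∑ i ∈ Finset.range (q + 1), bdfCoeff q i * y (tstar - i * τ)
      = τ * derivWithin y (Set.Icc 0 T) tstar
        + τ ^ (p + 1) * ∑ i ∈ Finset.range (q + 1), bdfCoeff q i * J i := by
    rw [Finset.sum_congr rfl fun i hi => by rw [hR i hi, mul_add, Finset.mul_sum],
      Finset.sum_add_distrib, Finset.sum_comm, Finset.mul_sum]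
    congr 1
    · have hk : ∀ k ∈ Finset.range (p + 1), ∑ i ∈ Finset.range (q + 1), bdfCoeff q i *
          (((k.factorial : ℝ)⁻¹ * τ ^ k *
          iteratedDerivWithin k y (Set.Icc 0 T) tstar) * (-(i : ℝ)) ^ k)
          = if k = 1 then τ * derivWithin y (Set.Icc 0 T) tstar else 0 := by
        intro k hk
        have hkp : k ≤ p := by simpa [Nat.lt_succ_iff] using hk
        have hm := bdf_moment q k (hkp.trans hpq) hq0 hq
        calc _ = ((k.factorial : ℝ)⁻¹ * τ ^ k * iteratedDerivWithin k y (Set.Icc 0 T) tstar) *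
              ∑ i ∈ Finset.range (q + 1), bdfCoeff q i * (-(i : ℝ)) ^ k := by
              rw [Finset.mul_sum]
              refine Finset.sum_congr rfl fun i _ => ?_
              ring
          _ = _ := by
              rw [hm]
              split_ifs with h1
              · subst h1
                simp [iteratedDerivWithin_one]
              · simp
      rw [Finset.sum_congr rfl hk, Finset.sum_ite_eq' , if_pos (by simp; omega)]
    · refine Finset.sum_congr rfl fun i _ => ?_
      ring
  have hint : ∫ s in (0 : ℝ)..(q : ℝ), (-(1 / (p.factorial : ℝ)) *
              ∑ i ∈ Finset.range (q + 1), bdfCoeff q i * (min (s - i) 0) ^ p) *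
            g (tstar - s * τ) = ∑ i ∈ Finset.range (q + 1), bdfCoeff q i * J i := by
    simp only [hJ, ← intervalIntegral.integral_const_mul]
    rw [← intervalIntegral.integral_finsetSum]
    · congr 1
      ext s
      rw [Finset.mul_sum, Finset.sum_mul]
      refine Finset.sum_congr rfl fun i _ => ?_
      ring
    · intro i _
      exact ((hcomp 0 q).continuousOn_mul (by fun_prop)).const_mul _
  rw [hsum, hint]
  field_simp
  ring
end

section
/- For every integer q with 1 ≤ q ≤ 5, the BDF-q generating polynomial δ(ζ) = Σ_{l=1}^{q} (1/l)(1−ζ)^l satisfies: (i) if ζ ∈ ℂ, |ζ| ≤ 1 and δ(ζ) = 0, then ζ = 1; and (ii) δ'(1) = −1, so ζ = 1 is a simple root of δ. In particular, the polynomial σ(ζ) defined by δ(ζ) = (1−ζ)·σ(ζ) has no root in the closed unit disk {ζ ∈ ℂ : |ζ| ≤ 1}. -/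
/-- The BDF-`q` generating polynomial `δ(ζ) = Σ_{l=1}^{q} (1/l)(1−ζ)^l`, over `ℂ`. -/
noncomputable def bdfPolyC (q : ℕ) : Polynomial ℂ :=
  ∑ l ∈ Finset.Icc 1 q, Polynomial.C ((l : ℂ)⁻¹) * (1 - Polynomial.X) ^ l

/-- A polynomial whose constant coefficient dominates has no root in the closed unit disk. -/
theorem dominant_ne_zero (a : ℝ) (b : ℕ → ℝ) (n : ℕ)
    (h : ∑ i ∈ Finset.range n, |b i| < a) (z : ℂ) (hz : ‖z‖ ≤ 1) :
    (a : ℂ) + ∑ i ∈ Finset.range n, (b i : ℂ) * z ^ (i + 1) ≠ 0 := by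
  intro h0
  have h1 : (a : ℂ) = -∑ i ∈ Finset.range n, (b i : ℂ) * z ^ (i + 1) :=
    eq_neg_of_add_eq_zero_left h0
  have h2 : ‖(a : ℂ)‖ ≤ ∑ i ∈ Finset.range n, |b i| := by
    rw [h1, norm_neg]
    refine (norm_sum_le _ _).trans (Finset.sum_le_sum fun i _ => ?_)
    rw [norm_mul, norm_pow, Complex.norm_real, Real.norm_eq_abs]
    exact mul_le_of_le_one_right (abs_nonneg _) (pow_le_one₀ (norm_nonneg _) hz)
  rw [Complex.norm_real, Real.norm_eq_abs] at h2
  linarith [le_abs_self a]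

/-- The value of the quotient polynomial is nonzero on the closed unit disk. -/
theorem sigma_ne_zero (q : ℕ) (hq1 : 1 ≤ q) (hq5 : q ≤ 5) (z : ℂ) (hz : ‖z‖ ≤ 1) :
    ∑ l ∈ Finset.range q, ((l + 1 : ℕ) : ℂ)⁻¹ * (1 - z) ^ l ≠ 0 := by
  intro h0
  interval_cases q <;> simp [Finset.sum_range_succ] at h0
  · have := dominant_ne_zero 3 (fun i => [-1].getD i 0) 1
      (by norm_num [Finset.sum_range_succ]) z hz
    apply this
    simp [Finset.sum_range_succ]
    linear_combination 2 * h0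
  · have := dominant_ne_zero 11 (fun i => [-7, 2].getD i 0) 2
      (by norm_num [Finset.sum_range_succ]) z hz
    apply this
    simp [Finset.sum_range_succ]
    linear_combination 6 * h0
  · have := dominant_ne_zero 625 (fun i => [0, -204, 224, -69].getD i 0) 4
      (by norm_num [Finset.sum_range_succ]) z hz
    apply this
    simp [Finset.sum_range_succ]
    linear_combination 12 * (25 + 23 * z) * h0
  · have := dominant_ne_zero 274 (fun i => [-52, 85, -15, 35, -39, 12].getD i 0) 6
      (by norm_num [Finset.sum_range_succ]) z hz
    apply this
    simp [Finset.sum_range_succ]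
    linear_combination 60 * (2 + 2 * z + z ^ 2) * h0

/-- The factorization of the generating polynomial. -/
theorem bdfPolyC_factor (q : ℕ) : bdfPolyC q = (1 - Polynomial.X) *
    ∑ l ∈ Finset.range q, Polynomial.C (((l + 1 : ℕ) : ℂ)⁻¹) * (1 - Polynomial.X) ^ l := by
  rw [bdfPolyC, Finset.mul_sum, ← Finset.Ico_add_one_right_eq_Icc, Finset.sum_Ico_eq_sum_range]
  refine Finset.sum_congr (by simp) fun l _ => ?_
  rw [add_comm 1 l]
  ring

/-- root localization (strengthened zero-stability) of the BDF methods of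
orders 1 to 5: (i) the only root of `δ` in the closed unit disk is `ζ = 1`;
(ii) `δ'(1) = −1`, so `ζ = 1` is a simple root; in particular the quotient polynomial
`σ` with `δ(ζ) = (1−ζ)σ(ζ)` has no root in the closed unit disk. -/
theorem bdf_root_localization (q : ℕ) (hq1 : 1 ≤ q) (hq5 : q ≤ 5) :
    (∀ ζ : ℂ, ‖ζ‖ ≤ 1 → (bdfPolyC q).eval ζ = 0 → ζ = 1) ∧
    (bdfPolyC q).derivative.eval 1 = -1 ∧
    ∀ σ : Polynomial ℂ, bdfPolyC q = (1 - Polynomial.X) * σ →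
      ∀ ζ : ℂ, ‖ζ‖ ≤ 1 → σ.eval ζ ≠ 0 := by
  have hs : ∀ ζ : ℂ, ‖ζ‖ ≤ 1 → (∑ l ∈ Finset.range q, Polynomial.C (((l + 1 : ℕ) : ℂ)⁻¹) *
      (1 - Polynomial.X) ^ l : Polynomial ℂ).eval ζ ≠ 0 := by
    intro ζ hζ
    have := sigma_ne_zero q hq1 hq5 ζ hζ
    simpa [Polynomial.eval_finset_sum] using this
  have hX : (1 - Polynomial.X : Polynomial ℂ) ≠ 0 := by
    intro h
    have := congrArg (Polynomial.eval 0) h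
    simp at this
  refine ⟨fun ζ hζ h => ?_, ?_, fun σ hσ ζ hζ => ?_⟩
  · rw [bdfPolyC_factor, Polynomial.eval_mul] at h
    rcases mul_eq_zero.mp h with h | h
    · simp at h
      exact (sub_eq_zero.mp h).symm
    · exact absurd h (hs ζ hζ)
  · rw [bdfPolyC_factor]
    interval_cases q <;> simp [Finset.sum_range_succ]
  · rw [bdfPolyC_factor] at hσ
    rw [← mul_left_cancel₀ hX hσ]
    exact hs ζ hζ
end

section
/- Let q ≥ 1 be an integer, let δ_0,…,δ_q be the BDF-q coefficients, let σ_0,…,σ_{q−1} be the real coefficients determined by the polynomial identity Σ_{j=0}^{q} δ_j ζ^j = (1−ζ)·Σ_{j=0}^{q−1} σ_j ζ^j (extended by σ_j = 0 for j < 0 and for j ≥ q), and let (χ_j)_{j≥0} be the unique real sequence with χ_0 σ_0 = 1 and Σ_{i=0}^{k} χ_i σ_{k−i} = 0 for all k ≥ 1 (the formal power series inverse of σ, which exists since σ_0 = Σ_{l=1}^{q} 1/l ≠ 0). Let τ > 0 and let (m^n)_{n≥0} be any sequence of real numbers; set ∂^τ m^n := (m^n − m^{n−1})/τ for n ≥ 1,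 ∂_q^τ m^n := (1/τ) Σ_{j=0}^{q} δ_j m^{n−j} for n ≥ q, and s^k := Σ_{i=1}^{q−1} σ_{k−i} ∂^τ m^i for k ≥ q (so s^k = 0 for k ≥ 2q−1). Then for every n ≥ q: ∂^τ m^n = Σ_{k=q}^{n} χ_{n−k} ( ∂_q^τ m^k − s^k ). -/
lemma bdf_aux_abel (σp : Polynomial ℝ) (a : ℕ → ℝ) (N : ℕ) :
    ∑ j ∈ Finset.range (N + 1), ((1 - Polynomial.X) * σp).coeff j * a j
      = ∑ j ∈ Finset.range N, σp.coeff j * (a j - a (j + 1)) + σp.coeff N * a N := by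
  induction N with
  | zero => simp [sub_mul]
  | succ N ih =>
    rw [Finset.sum_range_succ, ih, Finset.sum_range_succ]
    simp only [sub_mul, one_mul, Polynomial.coeff_sub, Polynomial.coeff_X_mul]
    ring

lemma bdf_aux_deg (q : ℕ) : (bdfPoly q).natDegree ≤ q := by
  unfold bdfPoly
  apply Polynomial.natDegree_sum_le_of_forall_le
  intro l hl
  have hl' := (Finset.mem_Icc.mp hl).2
  refine (Polynomial.natDegree_C_mul_le _ _).trans ?_
  refine Polynomial.natDegree_pow_le.trans ?_
  have h1 : (1 - Polynomial.X : Polynomial ℝ).natDegree ≤ 1 := by compute_degree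
  nlinarith

lemma bdf_aux_coeff (q : ℕ) (σp : Polynomial ℝ)
    (hσ : bdfPoly q = (1 - Polynomial.X) * σp) (j : ℕ) (hj : q ≤ j) : σp.coeff j = 0 := by
  by_cases h0 : σp = 0
  · simp [h0]
  apply Polynomial.coeff_eq_zero_of_natDegree_lt
  have h1 : (1 - Polynomial.X : Polynomial ℝ).natDegree = 1 := by
    compute_degree
    all_goals norm_num
  have hne : (1 - Polynomial.X : Polynomial ℝ) ≠ 0 := by
    intro h
    simp [h] at h1
  have h2 := bdf_aux_deg q
  rw [hσ, Polynomial.natDegree_mul hne h0, h1] at h2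
  omega

/-- discrete convolution identity rewriting the plain backward difference
`∂^τ m^n` in terms of the BDF-`q` differences `∂_q^τ m^k`. Here `σ` is the quotient
polynomial with `δ(ζ) = (1−ζ)σ(ζ)` (its coefficients vanish beyond degree `q−1`),
`(χ_j)` is the formal power series inverse of `σ`, characterized by `χ_0 σ_0 = 1` and
`Σ_{i=0}^k χ_i σ_{k−i} = 0` for `k ≥ 1`, and
`s^k = Σ_{i=1}^{q−1} σ_{k−i} ∂^τ m^i`. Then for `n ≥ q`:
`∂^τ m^n = Σ_{k=q}^{n} χ_{n−k} (∂_q^τ m^k − s^k)`. -/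
theorem bdf_convolution_identity (q : ℕ) (hq : 1 ≤ q)
    (σp : Polynomial ℝ) (hσ : bdfPoly q = (1 - Polynomial.X) * σp)
    (χ : ℕ → ℝ)
    (hχ0 : χ 0 * σp.coeff 0 = 1)
    (hχ : ∀ k : ℕ, 1 ≤ k → ∑ i ∈ Finset.range (k + 1), χ i * σp.coeff (k - i) = 0)
    (τ : ℝ) (hτ : 0 < τ) (m : ℕ → ℝ) (n : ℕ) (hn : q ≤ n) :
    (m n - m (n - 1)) / τ
      = ∑ k ∈ Finset.Icc q n, χ (n - k) *
          ((1 / τ) * (∑ j ∈ Finset.range (q + 1), (bdfPoly q).coeff j * m (k - j))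
            - ∑ i ∈ Finset.Icc 1 (q - 1), σp.coeff (k - i) * ((m i - m (i - 1)) / τ)) := by
  have hz := bdf_aux_coeff q σp hσ
  set d : ℕ → ℝ := fun i => (m i - m (i - 1)) / τ with hd
  have key : ∀ k ∈ Finset.Icc q n,
      (1 / τ) * (∑ j ∈ Finset.range (q + 1), (bdfPoly q).coeff j * m (k - j))
        - ∑ i ∈ Finset.Icc 1 (q - 1), σp.coeff (k - i) * ((m i - m (i - 1)) / τ)
      = ∑ i ∈ Finset.Icc q k, σp.coeff (k - i) * d i := by
    intro k hk
    have hqk := (Finset.mem_Icc.mp hk).1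
    rw [hσ, bdf_aux_abel σp (fun j => m (k - j)) q, hz q le_rfl, zero_mul, add_zero]
    have h1 : (1 / τ) * ∑ j ∈ Finset.range q, σp.coeff j * (m (k - j) - m (k - (j + 1)))
        = ∑ j ∈ Finset.range k, σp.coeff j * d (k - j) := by
      rw [← Finset.sum_subset (Finset.range_mono hqk), Finset.mul_sum]
      · apply Finset.sum_congr rfl
        intro j _
        simp only [hd, Nat.sub_sub]
        ring
      · intro j _ hj
        rw [hz j (by simpa using hj), zero_mul]
    have h2 : ∑ j ∈ Finset.range k, σp.coeff j * d (k - j)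
        = ∑ i ∈ Finset.Icc 1 k, σp.coeff (k - i) * d i := by
      refine Finset.sum_bij' (fun j _ => k - j) (fun i _ => k - i) ?_ ?_ ?_ ?_ ?_
      · intro j hj; simp only [Finset.mem_range, Finset.mem_Icc] at *; omega
      · intro j hj; simp only [Finset.mem_range, Finset.mem_Icc] at *; omega
      · intro j hj; simp only [Finset.mem_range, Finset.mem_Icc] at *; omega
      · intro j hj; simp only [Finset.mem_range, Finset.mem_Icc] at *; omega
      · intro j hj
        have : k - (k - j) = j := by
          simp only [Finset.mem_range] at hj; omega
        rw [this]
    have h3 : Finset.Icc 1 k = Finset.Icc 1 (q - 1) ∪ Finset.Icc q k := by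
      ext i; simp only [Finset.mem_union, Finset.mem_Icc]; omega
    have h4 : Disjoint (Finset.Icc 1 (q - 1)) (Finset.Icc q k) := by
      rw [Finset.disjoint_left]
      intro i; simp only [Finset.mem_Icc]; omega
    rw [h1, h2, h3, Finset.sum_union h4]
    simp only [hd]
    ring
  rw [Finset.sum_congr rfl (fun k hk => by rw [key k hk])]
  simp only [Finset.mul_sum]
  rw [Finset.sum_comm' (t' := Finset.Icc q n) (s' := fun i => Finset.Icc i n)
    (by intro x y; simp only [Finset.mem_Icc]; omega)]
  have inner : ∀ i ∈ Finset.Icc q n,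
      ∑ k ∈ Finset.Icc i n, χ (n - k) * (σp.coeff (k - i) * d i)
        = if i = n then d n else 0 := by
    intro i hi
    have hin := (Finset.mem_Icc.mp hi).2
    have h1 : ∑ k ∈ Finset.Icc i n, χ (n - k) * (σp.coeff (k - i) * d i)
        = (∑ r ∈ Finset.range (n - i + 1), χ r * σp.coeff (n - i - r)) * d i := by
      rw [Finset.sum_mul]
      refine Finset.sum_bij' (fun j _ => n - j) (fun r _ => n - r) ?_ ?_ ?_ ?_ ?_
      · intro j hj; simp only [Finset.mem_range, Finset.mem_Icc] at *; omega
      · intro j hj; simp only [Finset.mem_range, Finset.mem_Icc] at *; omega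
      · intro j hj; simp only [Finset.mem_range, Finset.mem_Icc] at *; omega
      · intro j hj; simp only [Finset.mem_range, Finset.mem_Icc] at *; omega
      · intro j hj
        have : n - i - (n - j) = j - i := by
          simp only [Finset.mem_Icc] at hj; omega
        rw [this, mul_assoc]
    rw [h1]
    split_ifs with h
    · subst h; simp [hχ0]
    · rw [hχ (n - i) (by omega), zero_mul]
  rw [Finset.sum_congr rfl inner, Finset.sum_ite_eq' (Finset.Icc q n) n (fun _ => d n),
    if_pos (by simp [hn])]
end
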